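/- Let m ≥ 1 and let e₁,…,e_m, f₁,…,f_m ∈ R satisfy: (i) for all indices j, k with |j−k| ≥ 2, each of e_j, f_j commutes with each of e_k, f_k (i.e. e_j·e_k = e_k·e_j, e_j·f_k = f_k·e_j, f_j·e_k = e_k·f_j, f_j·f_k = f_k·f_j); and (ii) f_j·e_{j+1} = q·(e_{j+1}·f_j) for 1 ≤ j ≤ m−1. Then in the multilinear expansion of P_m(e₁+f₁, e₂+f₂, …, e_m+f_m) only the 'descending' terms survive: P_m(e₁+f₁,…,e_m+f_m) = Σ_{l=0}^{m} P_m(e₁,…,e_l, f_{l+1},…,f_m), where the l-th summand has arguments e₁,…,e_l followed by f_{l+1},…,f_m. -/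

import Mathlib

noncomputable section

/-- The `t`-commutator `[a,b]_t = a*b - t•(b*a)`. -/
def qcomm {R : Type*} [Ring R] [Algebra ℂ R] (t : ℂ) (a b : R) : R :=
  a * b - t • (b * a)

/-- Left-nested iterated `q`-commutator:
`P (y₁,…,y_k) = [ … [[y₁,y₂]_q, y₃]_q …, y_k]_q`. -/
def PL {R : Type*} [Ring R] [Algebra ℂ R] (q : ℂ) : List R → R
  | [] => 1
  | y :: ys => ys.foldl (fun a b => qcomm q a b) y

section
variable {R : Type*} [Ring R] [Algebra ℂ R]

theorem qcomm_add_left (t : ℂ) (a b c : R) :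
    qcomm t (a + b) c = qcomm t a c + qcomm t b c := by
  simp only [qcomm, add_mul, mul_add, smul_add]
  abel

theorem qcomm_add_right (t : ℂ) (a b c : R) :
    qcomm t a (b + c) = qcomm t a b + qcomm t a c := by
  simp only [qcomm, add_mul, mul_add, smul_add]
  abel

theorem qcomm_sum_left {ι : Type*} (t : ℂ) (s : Finset ι) (a : ι → R) (c : R) :
    qcomm t (∑ i ∈ s, a i) c = ∑ i ∈ s, qcomm t (a i) c := by
  simp only [qcomm, Finset.sum_mul, Finset.mul_sum, Finset.smul_sum, Finset.sum_sub_distrib]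

theorem Commute.qcomm_left {t : ℂ} {a b x : R} (ha : Commute a x) (hb : Commute b x) :
    Commute (qcomm t a b) x :=
  (ha.mul_left hb).sub_left ((hb.mul_left ha).smul_left t)

/-- If `A` commutes with `x`, then `[[A,b]_t,x]_t = [A,[b,x]_t]_t`. -/
theorem qcomm_assoc_of_commute {t : ℂ} {A b x : R} (hA : Commute A x) :
    qcomm t (qcomm t A b) x = qcomm t A (qcomm t b x) := by
  have h₁ : b * A * x = b * x * A := by rw [mul_assoc, hA.eq, mul_assoc]
  have h₂ : x * (A * b) = A * (x * b) := by rw [← mul_assoc, ← hA.eq, mul_assoc]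
  simp only [qcomm, sub_mul, mul_sub, smul_sub, smul_mul_assoc, mul_smul_comm, h₁, h₂, mul_assoc]
  abel

@[simp]
theorem PL_singleton (q : ℂ) (y : R) : PL q [y] = y :=
  rfl

theorem PL_ofFn_succ_last (q : ℂ) {n : ℕ} (y : Fin (n + 2) → R) :
    PL q (List.ofFn y) =
      qcomm q (PL q (List.ofFn fun j : Fin (n + 1) => y j.castSucc)) (y (Fin.last _)) := by
  rw [List.ofFn_succ' y, List.concat_eq_append, List.ofFn_succ]
  simp [PL, List.foldl_append]

theorem commute_PL_ofFn (q : ℂ) {n : ℕ} (y : Fin n → R) (x : R) (h : ∀ j, Commute (y j) x) :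
    Commute (PL q (List.ofFn y)) x := by
  match n with
  | 0 => simp [PL]
  | 1 => simpa using h 0
  | n + 2 =>
    rw [PL_ofFn_succ_last]
    exact (commute_PL_ofFn q _ x fun j => h j.castSucc).qcomm_left (h _)

/-- `[P(y₁,…,yₙ),x]_q` vanishes when `[yₙ,x]_q` does and `x` commutes with `y₁,…,yₙ₋₁`. -/
theorem qcomm_PL_ofFn_eq_zero (q : ℂ) {n : ℕ} (y : Fin (n + 1) → R) (x : R)
    (h : ∀ j : Fin n, Commute (y j.castSucc) x) (hlast : qcomm q (y (Fin.last n)) x = 0) :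
    qcomm q (PL q (List.ofFn y)) x = 0 := by
  cases n with
  | zero => simpa using hlast
  | succ n =>
    rw [PL_ofFn_succ_last, qcomm_assoc_of_commute (commute_PL_ofFn q _ x h), hlast]
    simp [qcomm]

end

/-- In the multilinear expansion of `P_m(e₁+f₁,…,e_m+f_m)` only the descending
terms survive:
`P_m(e₁+f₁,…,e_m+f_m) = Σ_{l=0}^{m} P_m(e₁,…,e_l, f_{l+1},…,f_m)`. -/
theorem PL_sum_descending {R : Type*} [Ring R] [Algebra ℂ R]
    (q : ℂ) (hq : q ≠ 0) (m : ℕ) (hm : 1 ≤ m) (e f : Fin m → R)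
    (hfar : ∀ j l : Fin m, (j : ℕ) + 1 < (l : ℕ) →
      e j * e l = e l * e j ∧ e j * f l = f l * e j ∧
      f j * e l = e l * f j ∧ f j * f l = f l * f j)
    (hfe : ∀ j l : Fin m, (l : ℕ) = (j : ℕ) + 1 → f j * e l = q • (e l * f j)) :
    PL q (List.ofFn fun j : Fin m => e j + f j) =
      ∑ l ∈ Finset.range (m + 1),
        PL q (List.ofFn fun j : Fin m => if (j : ℕ) < l then e j else f j) := by
  clear hq
  obtain ⟨n, rfl⟩ : ∃ n, m = n + 1 := ⟨m - 1, by omega⟩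
  clear hm
  induction n with
  | zero => simp [Finset.sum_range_succ, add_comm]
  | succ n ih =>
    have ih' := ih (fun j => e j.castSucc) (fun j => f j.castSucc)
      (fun j l h => hfar _ _ (by simpa using h)) (fun j l h => hfe _ _ (by simpa using h))
    rw [PL_ofFn_succ_last, ih', qcomm_add_right, Finset.sum_range_succ _ (n + 1 + 1),
      add_comm (qcomm _ _ _)]
    congr 1
    · rw [qcomm_sum_left]
      refine Finset.sum_congr rfl fun l hl => ?_
      have hl' : ¬ n + 1 < l := by simpa [Nat.lt_succ_iff] using hl
      rw [PL_ofFn_succ_last q (n := n)]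
      simp only [Fin.val_castSucc, Fin.val_last, if_neg hl']
    · rw [Finset.sum_range_succ, qcomm_add_left, qcomm_sum_left, Finset.sum_eq_zero, zero_add,
        PL_ofFn_succ_last q (n := n)]
      · have h₁ (j : Fin (n + 1)) : (j : ℕ) < n + 1 + 1 := by omega
        simp [h₁]
      · intro l hl
        have hl' : ¬ n < l := by simpa [Nat.lt_succ_iff] using hl
        refine qcomm_PL_ofFn_eq_zero q _ _ (fun j => ?_) ?_
        · obtain ⟨hee, -, hfe', -⟩ := hfar j.castSucc.castSucc (Fin.last _) (by simp)
          split_ifs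
          exacts [hee, hfe']
        · simpa [qcomm, hl', sub_eq_zero] using hfe (Fin.last n).castSucc (Fin.last _) (by simp)
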